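/- Let F : ℂ₊ → B be a bounded continuous function with values in a Banach space B, holomorphic in the open upper half-plane, and let 𝒞 be a C¹ curve ζ(t) in the closed upper half-plane with ζ(t) = t for t in a compact interval J and Im ζ(t) > 0 for t ∉ J, ζ(t) = t + i for |t| large. Then for every z = x + iy strictly above 𝒞, F(z) = (1/π) ∫_𝒞 (y F(ζ))/((x − ζ)² + y²) dζ. -/

import Mathlib

open Complex MeasureTheory

open Filter Topology

lemma exists_ball_of_isCompact_upperHalfPlane {K : Set ℂ} (hK : IsCompact K)
    (hpos : ∀ w ∈ K, 0 < w.im) :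
    ∃ (c : ℂ) (r : ℝ), K ⊆ Metric.ball c r ∧ Metric.ball c r ⊆ {z : ℂ | 0 < z.im} := by
  rcases K.eq_empty_or_nonempty with rfl | hne
  · exact ⟨0, 0, by simp, by simp⟩
  obtain ⟨w₀, hw₀, hmin⟩ := hK.exists_isMinOn hne continuous_im.continuousOn
  obtain ⟨R, hR⟩ := hK.isBounded.exists_norm_le
  have hm : 0 < w₀.im := hpos w₀ hw₀
  have hN : 0 < (R ^ 2 + 1) / w₀.im := by positivity
  refine ⟨((R ^ 2 + 1) / w₀.im : ℝ) * I, (R ^ 2 + 1) / w₀.im, fun w hw => ?_, fun w hw => ?_⟩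
  all_goals set N := (R ^ 2 + 1) / w₀.im with hNdef
  · have h1 : w₀.im ≤ w.im := hmin hw
    have h2 : w.re * w.re + w.im * w.im ≤ R ^ 2 := by
      have := hR w hw
      rw [← normSq_apply, normSq_eq_norm_sq]
      gcongr
    have h3 : N * w₀.im = R ^ 2 + 1 := by rw [hNdef]; field_simp
    rw [mem_ball_iff_norm, ← sq_lt_sq₀ (norm_nonneg _) hN.le, ← normSq_eq_norm_sq, normSq_apply]
    simp only [sub_re, sub_im, mul_re, mul_im, ofReal_re, ofReal_im, I_re, I_im]
    nlinarith [mul_le_mul_of_nonneg_left h1 hN.le]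
  · rw [mem_ball_iff_norm, ← sq_lt_sq₀ (norm_nonneg _) hN.le, ← normSq_eq_norm_sq, normSq_apply] at hw
    simp only [sub_re, sub_im, mul_re, mul_im, ofReal_re, ofReal_im, I_re, I_im] at hw
    change 0 < w.im
    by_contra! h
    nlinarith [mul_nonneg hN.le (neg_nonneg.2 h), sq_nonneg w.re, sq_nonneg w.im]

section

variable {B : Type*} [NormedAddCommGroup B] [NormedSpace ℂ B] [CompleteSpace B]

/-- Deform the path to the three other sides of a rectangle with corners `±T + i h`,
`±T + i (h + T)`. -/
lemma norm_integral_curve_le_of_bound_outside_ball {g : ℂ → B} {c c' : ℝ → ℂ} {T h D : ℝ}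
    (hT : 0 < T) (hh : 0 < h) (hg : DifferentiableOn ℂ g {z : ℂ | 0 < z.im})
    (hD : ∀ w : ℂ, 0 < w.im → T ≤ ‖w‖ → ‖g w‖ ≤ D)
    (hc : ∀ t, HasDerivAt c (c' t) t) (hc' : Continuous c') (hpos : ∀ t, 0 < (c t).im)
    (hright : c T = T + h * I) (hleft : c (-T) = -T + h * I) :
    ‖∫ t in -T..T, c' t • g (c t)‖ ≤ 4 * T * D := by
  have hcc : Continuous c := continuous_iff_continuousAt.2 fun t => (hc t).continuousAt
  set p : ℂ := T + (h + T : ℝ) * I with hp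
  set q : ℂ := -T + (h + T : ℝ) * I with hq
  obtain ⟨o, r, hK, hball⟩ := exists_ball_of_isCompact_upperHalfPlane
    (K := {p, q} ∪ c '' Set.Icc (-T) T)
    ((Set.toFinite _).isCompact.union (isCompact_Icc.image hcc)) (by
      rintro w ((rfl | rfl) | ⟨t, -, rfl⟩)
      · simp [hp]; positivity
      · simp [hq]; positivity
      · exact hpos t)
  obtain ⟨P, hP⟩ := (hg.mono hball).isExactOn_ball
  have hmem : ∀ t ∈ Set.Icc (-T) T, c t ∈ Metric.ball o r := fun t ht =>
    hK (Or.inr ⟨t, ht, rfl⟩)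
  have hTT : -T ≤ T := by linarith
  have hintegral : ∫ t in -T..T, c' t • g (c t) = P (c T) - P (c (-T)) := by
    apply intervalIntegral.integral_eq_sub_of_hasDerivAt (f := P ∘ c)
    · intro t ht
      rw [Set.uIcc_of_le hTT] at ht
      exact (hP _ (hmem t ht)).scomp t (hc t)
    · refine ContinuousOn.intervalIntegrable ?_
      rw [Set.uIcc_of_le hTT]
      exact hc'.continuousOn.smul (hg.continuousOn.comp hcc.continuousOn fun t _ => hpos t)
  have key : ∀ (s : Set ℂ), Convex ℝ s → (∀ w ∈ s, T ≤ ‖w‖) → ∀ u v : ℂ,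
      u ∈ Metric.ball o r → v ∈ Metric.ball o r → u ∈ s → v ∈ s →
      ‖P v - P u‖ ≤ D * ‖v - u‖ := fun s hs hsT u v hu hv hus hvs =>
    ((convex_ball o r).inter hs).norm_image_sub_le_of_norm_hasDerivWithin_le
      (fun w hw => (hP w hw.1).hasDerivWithinAt)
      (fun w hw => hD w (hball hw.1) (hsT w hw.2)) ⟨hu, hus⟩ ⟨hv, hvs⟩
  have hpK : p ∈ Metric.ball o r := hK (by simp)
  have hqK : q ∈ Metric.ball o r := hK (by simp)
  have hl : c (-T) ∈ Metric.ball o r := hmem _ (by simp [hTT])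
  have hr : c T ∈ Metric.ball o r := hmem _ (by simp [hTT])
  have e1 := key {w | w.re ≤ -T} (convex_halfSpace_re_le _)
    (fun w (hw : w.re ≤ -T) => (by linarith : T ≤ -w.re).trans
      ((neg_le_abs _).trans (abs_re_le_norm w))) (c (-T)) q hl hqK
    (by simp [hleft]) (by simp [hq])
  have e2 := key {w | T ≤ w.im} (convex_halfSpace_im_ge _)
    (fun w (hw : T ≤ w.im) => hw.trans ((le_abs_self _).trans (abs_im_le_norm w))) q p hqK hpK
    (by simp [hq, hh.le]) (by simp [hp, hh.le])
  have e3 := key {w | T ≤ w.re} (convex_halfSpace_re_ge _)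
    (fun w (hw : T ≤ w.re) => hw.trans ((le_abs_self _).trans (abs_re_le_norm w))) p (c T) hpK hr
    (by simp [hp]) (by simp [hright])
  have n1 : ‖q - c (-T)‖ = T := by
    rw [hleft, show q - (-T + h * I) = T * I by rw [hq]; push_cast; ring]
    simp [abs_of_pos hT]
  have n2 : ‖p - q‖ = 2 * T := by
    rw [show p - q = ((2 * T : ℝ) : ℂ) by rw [hp, hq]; push_cast; ring]
    simp [abs_of_pos hT]
  have n3 : ‖c T - p‖ = T := by
    rw [hright, show (T + h * I : ℂ) - p = -(T * I) by rw [hp]; push_cast; ring]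
    simp [abs_of_pos hT]
  rw [n1] at e1
  rw [n2] at e2
  rw [n3] at e3
  rw [hintegral, show P (c T) - P (c (-T)) = (P (c T) - P p) + (P p - P q) + (P q - P (c (-T))) by abel]
  refine (norm_add₃_le).trans ?_
  linarith

lemma norm_integral_graph_le_of_bound_outside_ball {g : ℂ → B} {γ γ' : ℝ → ℝ} {T h D : ℝ}
    (hT : 0 < T) (hγ : ∀ t, HasDerivAt γ (γ' t) t) (hγ'c : Continuous γ') (hγ0 : ∀ t, 0 ≤ γ t)
    (hright : γ T = h) (hleft : γ (-T) = h)
    (hg : DifferentiableOn ℂ g {z : ℂ | 0 < z.im})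
    (hgc : ContinuousOn g {z : ℂ | γ z.re ≤ z.im})
    (hD : ∀ w : ℂ, 0 < w.im → T ≤ ‖w‖ → ‖g w‖ ≤ D) :
    ‖∫ t in -T..T, (1 + (γ' t : ℂ) * I) • g (t + γ t * I)‖ ≤ 4 * T * D := by
  have hγc : Continuous γ := continuous_iff_continuousAt.2 fun t => (hγ t).continuousAt
  have hcont : Continuous fun s : ℝ =>
      ∫ t in -T..T, (1 + (γ' t : ℂ) * I) • g (t + (γ t + |s| : ℝ) * I) := by
    apply intervalIntegral.continuous_parametric_intervalIntegral_of_continuous'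
    refine Continuous.smul (by fun_prop) (hgc.comp_continuous (by fun_prop) fun p => ?_)
    simp
  have hlim := (hcont.norm.tendsto 0).mono_left (nhdsWithin_le_nhds (s := Set.Ioi 0))
  simp only [abs_zero, add_zero] at hlim
  refine le_of_tendsto hlim ?_
  filter_upwards [self_mem_nhdsWithin] with s hs
  have hs : 0 < |s| := abs_pos.2 (ne_of_gt hs)
  refine norm_integral_curve_le_of_bound_outside_ball
    (c := fun t : ℝ => (t : ℂ) + (γ t + |s| : ℝ) * I) (h := h + |s|) hT ?_ hg hD (fun t => ?_)
    (by fun_prop) (fun t => ?_) (by simp [hright]) (by simp [hleft])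
  · linarith [hγ0 T]
  · exact (hasDerivAt_id t).ofReal_comp.add ((((hγ t).add_const |s|).ofReal_comp).mul_const I)
  · simpa using add_pos_of_nonneg_of_pos (hγ0 t) hs

end

lemma tendsto_log_sub_log {u v : ℂ} (α β : ℂ) (hu : u ∈ slitPlane) (hv : v ∈ slitPlane) :
    Tendsto (fun T : ℝ => log (T * u + α) - log (T * v + β)) atTop (𝓝 (log u - log v)) := by
  have hinv : Tendsto (fun T : ℝ => ((T⁻¹ : ℝ) : ℂ)) atTop (𝓝 0) := by
    exact_mod_cast (continuous_ofReal.tendsto 0).comp tendsto_inv_atTop_zero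
  have hdiv : ∀ w δ : ℂ, Tendsto (fun T : ℝ => w + (T⁻¹ : ℝ) * δ) atTop (𝓝 w) := fun w δ => by
    simpa using (hinv.mul_const δ).const_add w
  refine (((hdiv u α).clog hu).sub ((hdiv v β).clog hv)).congr' ?_
  filter_upwards [(hdiv u α).eventually_ne (slitPlane_ne_zero hu),
    (hdiv v β).eventually_ne (slitPlane_ne_zero hv), eventually_gt_atTop 0] with T h1 h2 hT
  have hT' : (T : ℂ) ≠ 0 := by exact_mod_cast hT.ne'
  have e : ∀ w δ : ℂ, T * w + δ = T * (w + (T⁻¹ : ℝ) * δ) := fun w δ => by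
    push_cast; field_simp
  rw [e u, e v, log_ofReal_mul hT h1, log_ofReal_mul hT h2]
  ring

lemma poisson_denominator_eq (x y : ℝ) (w : ℂ) :
    ((x : ℂ) - w) ^ 2 + (y : ℂ) ^ 2 = (w - (x + y * I)) * (w - (x - y * I)) := by
  linear_combination (y : ℂ) ^ 2 * I_sq

lemma graph_ne_of_lt {γ : ℝ → ℝ} {x y : ℝ} (hxy : γ x < y) (t : ℝ) :
    (t : ℂ) + γ t * I - (x + y * I) ≠ 0 := by
  intro h
  have hre := congrArg re h
  have him := congrArg im h
  simp at hre him
  obtain rfl : t = x := by linarith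
  linarith

lemma sub_conj_ne_of_nonneg {w : ℂ} {x y : ℝ} (hw : 0 ≤ w.im) (hy : 0 < y) :
    w - (x - y * I) ≠ 0 := by
  intro h
  have him := congrArg im h
  simp at him
  linarith

lemma continuous_poisson_kernel_graph {γ γ' : ℝ → ℝ} {x y : ℝ}
    (hγc : Continuous γ) (hγ'c : Continuous γ') (hγ0 : ∀ t, 0 ≤ γ t) (hxy : γ x < y) :
    Continuous fun t : ℝ =>
      ((y : ℂ) / (((x : ℂ) - ((t : ℂ) + γ t * I)) ^ 2 + (y : ℂ) ^ 2)) * (1 + (γ' t : ℂ) * I) := by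
  refine Continuous.mul (continuous_const.div (by fun_prop) fun t => ?_) (by fun_prop)
  rw [poisson_denominator_eq]
  exact mul_ne_zero (graph_ne_of_lt hxy t)
    (sub_conj_ne_of_nonneg (by simpa using hγ0 t) ((hγ0 x).trans_lt hxy))

lemma tendsto_integral_poisson_kernel_graph {γ γ' : ℝ → ℝ} {x y R : ℝ}
    (hγ : ∀ t, HasDerivAt γ (γ' t) t) (hγ'c : Continuous γ') (hγ0 : ∀ t, 0 ≤ γ t)
    (hfar : ∀ t : ℝ, R ≤ |t| → γ t = 1) (hxy : γ x < y) :
    Tendsto (fun T : ℝ => ∫ t in -T..T,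
      ((y : ℂ) / (((x : ℂ) - ((t : ℂ) + γ t * I)) ^ 2 + (y : ℂ) ^ 2)) * (1 + (γ' t : ℂ) * I))
      atTop (𝓝 (Real.pi : ℂ)) := by
  have hγc : Continuous γ := continuous_iff_continuousAt.2 fun t => (hγ t).continuousAt
  have hy : 0 < y := (hγ0 x).trans_lt hxy
  have hne1 := fun t => graph_ne_of_lt hxy t
  have hne2 : ∀ t : ℝ, (t : ℂ) + γ t * I - (x - y * I) ≠ 0 := fun t =>
    sub_conj_ne_of_nonneg (by simpa using hγ0 t) hy
  set L : ℝ → ℂ := fun t => log (I * (t + γ t * I - (x + y * I))) -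
    log (-I * (t + γ t * I - (x - y * I))) with hL
  have hζ : ∀ t : ℝ, HasDerivAt (fun t : ℝ => (t : ℂ) + γ t * I) (1 + γ' t * I) t := fun t =>
    (hasDerivAt_id t).ofReal_comp.add ((hγ t).ofReal_comp.mul_const I)
  have hderiv : ∀ t : ℝ, HasDerivAt (fun t => (2 * I)⁻¹ * L t)
      (((y : ℂ) / (((x : ℂ) - ((t : ℂ) + γ t * I)) ^ 2 + (y : ℂ) ^ 2)) *
        (1 + (γ' t : ℂ) * I)) t := by
    intro t
    have s1 : I * ((t : ℂ) + γ t * I - (x + y * I)) ∈ slitPlane := by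
      rw [mem_slitPlane_iff]
      rcases eq_or_ne t x with rfl | h
      · left; simp; linarith
      · right; simpa [sub_eq_zero] using h
    have s2 : -I * ((t : ℂ) + γ t * I - (x - y * I)) ∈ slitPlane := by
      rw [mem_slitPlane_iff]
      left; simp; linarith [hγ0 t]
    have h := (((((hζ t).sub_const (x + y * I : ℂ)).const_mul I).clog_real s1).sub
      ((((hζ t).sub_const (x - y * I : ℂ)).const_mul (-I)).clog_real s2)).const_mul (2 * I)⁻¹
    refine h.congr_deriv ?_
    rw [poisson_denominator_eq]
    have ha := hne1 t
    have hb := hne2 t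
    have hab : (t : ℂ) + γ t * I - (x - y * I) = t + γ t * I - (x + y * I) + 2 * I * y := by ring
    rw [hab] at hb ⊢
    generalize (t : ℂ) + γ t * I - (x + y * I) = w at ha hb ⊢
    have := I_ne_zero
    field_simp
    ring
  have hintegral : ∀ T : ℝ, ∫ t in -T..T,
      ((y : ℂ) / (((x : ℂ) - ((t : ℂ) + γ t * I)) ^ 2 + (y : ℂ) ^ 2)) * (1 + (γ' t : ℂ) * I) =
      (2 * I)⁻¹ * (L T - L (-T)) := by
    intro T
    rw [mul_sub]
    exact intervalIntegral.integral_eq_sub_of_hasDerivAt (fun t _ => hderiv t)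
      ((continuous_poisson_kernel_graph hγc hγ'c hγ0 hxy).intervalIntegrable _ _)
  simp_rw [hintegral]
  have hI : I ∈ slitPlane := by simp [mem_slitPlane_iff]
  have hnI : -I ∈ slitPlane := by simp [mem_slitPlane_iff]
  have hright := tendsto_log_sub_log (I * (I - (x + y * I))) (-I * (I - (x - y * I))) hI hnI
  have hleft := tendsto_log_sub_log (I * (I - (x + y * I))) (-I * (I - (x - y * I))) hnI hI
  have hlim := (hright.sub hleft).const_mul (2 * I)⁻¹
  have hval : (2 * I)⁻¹ * (log I - log (-I) - (log (-I) - log I)) = (Real.pi : ℂ) := by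
    rw [log_I, log_neg_I]
    have := I_ne_zero
    field_simp
    ring
  rw [hval] at hlim
  refine hlim.congr' ?_
  filter_upwards [eventually_ge_atTop R, eventually_ge_atTop 0] with T hT hT0
  have g1 : γ T = 1 := hfar T (hT.trans (le_abs_self T))
  have g2 : γ (-T) = 1 := hfar (-T) (by rw [abs_neg]; exact hT.trans (le_abs_self T))
  simp only [hL, g1, g2]
  congr 1
  push_cast
  congr 3 <;> ring_nf

lemma norm_conj_add_mul_I (x y : ℝ) : ‖(x - y * I : ℂ)‖ = ‖(x + y * I : ℂ)‖ := by
  rw [← norm_conj]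
  simp

/-- Far from the origin, the two factors of the Poisson denominator are at least half of `T`. -/
lemma half_le_norm_sub {w z : ℂ} {T : ℝ} (hT : 2 * ‖z‖ ≤ T) (hw : T ≤ ‖w‖) :
    T / 2 ≤ ‖w - z‖ := by
  linarith [norm_sub_norm_le w z]

section

variable {B : Type*} [NormedAddCommGroup B] [NormedSpace ℂ B]

lemma norm_smul_dslope_le {F : ℂ → B} {M x y T : ℝ} {w : ℂ} (hy : 0 < y) (hT0 : 0 < T)
    (hT : 2 * ‖(x + y * I : ℂ)‖ ≤ T) (hwT : T ≤ ‖w‖)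
    (hFw : ‖F w‖ ≤ M) (hFz : ‖F (x + y * I)‖ ≤ M) :
    ‖((y : ℂ) / (w - (x - y * I))) • dslope F (x + y * I) w‖ ≤ 8 * y * M / T ^ 2 := by
  have h1 := half_le_norm_sub hT hwT
  have h2 := half_le_norm_sub (z := x - y * I) (by rwa [norm_conj_add_mul_I]) hwT
  have hne : w ≠ x + y * I := by
    rintro rfl
    rw [sub_self, norm_zero] at h1
    linarith
  have hF : ‖F w - F (x + y * I)‖ ≤ 2 * M := (norm_sub_le _ _).trans (by linarith)
  rw [dslope_of_ne _ hne, slope_def_module, norm_smul, norm_smul, norm_div, norm_inv, norm_real,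
    Real.norm_of_nonneg hy.le]
  calc y / ‖w - (x - y * I)‖ * (‖w - (x + y * I)‖⁻¹ * ‖F w - F (x + y * I)‖)
      ≤ y / (T / 2) * ((T / 2)⁻¹ * (2 * M)) := by gcongr
    _ = 8 * y * M / T ^ 2 := by field_simp; ring

lemma integrable_poisson_kernel_graph_smul {f : ℝ → B} {γ γ' : ℝ → ℝ} {x y R M : ℝ}
    (hγ : ∀ t, HasDerivAt γ (γ' t) t) (hγ'c : Continuous γ') (hγ0 : ∀ t, 0 ≤ γ t)
    (hfar : ∀ t : ℝ, R ≤ |t| → γ t = 1) (hxy : γ x < y)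
    (hf : Continuous f) (hfM : ∀ t, R ≤ |t| → ‖f t‖ ≤ M) :
    Integrable fun t : ℝ =>
      (((y : ℂ) / (((x : ℂ) - ((t : ℂ) + γ t * I)) ^ 2 + (y : ℂ) ^ 2)) *
        (1 + (γ' t : ℂ) * I)) • f t := by
  have hγc : Continuous γ := continuous_iff_continuousAt.2 fun t => (hγ t).continuousAt
  have hy : 0 < y := (hγ0 x).trans_lt hxy
  refine (Continuous.locallyIntegrable
    ((continuous_poisson_kernel_graph hγc hγ'c hγ0 hxy).fun_smul hf)).integrable_of_isBigO_cocompact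
    (g := fun t : ℝ => (1 + t ^ 2)⁻¹) ?_ (integrable_inv_one_add_sq.integrableAtFilter _)
  refine Asymptotics.IsBigO.of_bound (8 * y * M) ?_
  have hev := tendsto_norm_cocompact_atTop (E := ℝ)
  filter_upwards [hev.eventually_gt_atTop R, hev.eventually_ge_atTop 1,
    hev.eventually_ge_atTop (2 * ‖(x + y * I : ℂ)‖)] with t hR h1 hz
  rw [Real.norm_eq_abs] at hR h1 hz
  have hγ't : γ' t = 0 := by
    refine (hγ t).unique ((hasDerivAt_const t (1 : ℝ)).congr_of_eventuallyEq ?_)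
    filter_upwards [continuous_abs.continuousAt.eventually_const_lt hR] with s hs using
      hfar s hs.le
  have hnorm : |t| ≤ ‖(t : ℂ) + γ t * I‖ := by
    simpa using abs_re_le_norm ((t : ℂ) + γ t * I)
  have b1 := half_le_norm_sub hz hnorm
  have b2 := half_le_norm_sub (z := x - y * I) (by rwa [norm_conj_add_mul_I]) hnorm
  have hft := hfM t hR.le
  have hM : 0 ≤ M := (norm_nonneg _).trans hft
  rw [poisson_denominator_eq, hγ't, norm_smul, Real.norm_of_nonneg (by positivity)]
  simp only [ofReal_zero, zero_mul, add_zero, mul_one]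
  rw [norm_div, norm_mul, norm_real, Real.norm_of_nonneg hy.le]
  calc _ ≤ y / (|t| / 2 * (|t| / 2)) * M := by gcongr
    _ = 8 * y * M * (2 * t ^ 2)⁻¹ := by
      have : t ≠ 0 := by rintro rfl; norm_num at h1
      rw [← sq_abs t]
      field_simp
      ring
    _ ≤ 8 * y * M * (1 + t ^ 2)⁻¹ := by
      have : 1 ≤ t ^ 2 := (one_le_sq_iff_one_le_abs t).2 h1
      gcongr
      linarith

end

/- Statement 14: Poisson-type representation along a curve 𝒞 (a graph ζ(t) = t + iγ(t)
coinciding with ℝ on J and with ℝ + i far out): for z = x + iy strictly above 𝒞,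
F(z) = (1/π) ∫_𝒞 y F(ζ) / ((x−ζ)² + y²) dζ. -/
theorem stmt_14 {B : Type*} [NormedAddCommGroup B] [NormedSpace ℂ B] [CompleteSpace B]
    (F : ℂ → B) (M : ℝ)
    (γ γ' : ℝ → ℝ) (a b R₀ : ℝ) (hab : a < b)
    (hγ : ∀ t, HasDerivAt γ (γ' t) t) (hγ'c : Continuous γ')
    (hJ : ∀ t ∈ Set.Icc a b, γ t = 0)
    (hout : ∀ t ∉ Set.Icc a b, 0 < γ t)
    (hfar : ∀ t : ℝ, R₀ ≤ |t| → γ t = 1)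
    (hol : DifferentiableOn ℂ F {z : ℂ | 0 < z.im})
    (hbd : ∀ z : ℂ, 0 < z.im → ‖F z‖ ≤ M)
    (hcont : ContinuousOn F {z : ℂ | γ z.re ≤ z.im}) :
    ∀ x y : ℝ, γ x < y →
      F ((x : ℂ) + (y : ℂ) * I)
        = ((1 / Real.pi : ℝ) : ℂ) •
            ∫ t : ℝ,
              (((y : ℂ) / (((x : ℂ) - ((t : ℂ) + (γ t : ℂ) * I)) ^ 2 + (y : ℂ) ^ 2)) *
                  (1 + (γ' t : ℂ) * I)) •
                F ((t : ℂ) + (γ t : ℂ) * I) := by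
  intro x y hxy
  have hγc : Continuous γ := continuous_iff_continuousAt.2 fun t => (hγ t).continuousAt
  have hγ0 : ∀ t, 0 ≤ γ t := fun t => by
    by_cases ht : t ∈ Set.Icc a b
    · exact (hJ t ht).ge
    · exact (hout t ht).le
  have hy : 0 < y := (hγ0 x).trans_lt hxy
  set z : ℂ := x + y * I with hz
  have hzim : 0 < z.im := by simpa [hz] using hy
  have hζ : Continuous fun t : ℝ => (t : ℂ) + γ t * I := by fun_prop
  have hFζ : Continuous fun t : ℝ => F (t + γ t * I) :=
    hcont.comp_continuous hζ fun t => by simp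
  have hU : {w : ℂ | 0 < w.im} ∈ 𝓝 z :=
    (isOpen_lt continuous_const continuous_im).mem_nhds hzim
  have hE : {w : ℂ | γ w.re ≤ w.im} ∈ 𝓝 z := by
    filter_upwards [(isOpen_lt (hγc.comp continuous_re) continuous_im).mem_nhds
      (show γ z.re < z.im by simpa [hz] using hxy)] with w hw using le_of_lt hw
  set g : ℂ → B := fun w => ((y : ℂ) / (w - (x - y * I))) • dslope F z w with hg
  have hgd : DifferentiableOn ℂ g {w : ℂ | 0 < w.im} :=
    .smul (.div (by fun_prop) (by fun_prop) fun w hw => sub_conj_ne_of_nonneg (le_of_lt hw) hy)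
      ((Complex.differentiableOn_dslope hU).2 hol)
  have hgc : ContinuousOn g {w : ℂ | γ w.re ≤ w.im} :=
    .smul (.div (by fun_prop) (by fun_prop) fun w hw =>
      sub_conj_ne_of_nonneg ((hγ0 _).trans hw) hy)
      ((continuousOn_dslope hE).2 ⟨hcont, hol.differentiableAt hU⟩)
  have hzero : Tendsto (fun T : ℝ => ∫ t in -T..T, (1 + (γ' t : ℂ) * I) • g (t + γ t * I))
      atTop (𝓝 0) := by
    refine squeeze_zero_norm' (a := fun T => 32 * y * M * T⁻¹) ?_
      (by simpa using tendsto_inv_atTop_zero.const_mul (32 * y * M))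
    filter_upwards [eventually_ge_atTop R₀, eventually_gt_atTop 0, eventually_ge_atTop (2 * ‖z‖)]
      with T hR hT hTz
    refine (norm_integral_graph_le_of_bound_outside_ball hT hγ hγ'c hγ0
      (hfar T (hR.trans (le_abs_self T)))
      (hfar (-T) (by rw [abs_neg]; exact hR.trans (le_abs_self T))) hgd hgc
      fun w hw hwT => norm_smul_dslope_le hy hT hTz hwT (hbd w hw) (hbd z hzim)).trans_eq ?_
    field_simp
    ring
  set k : ℝ → ℂ := fun t => ((y : ℂ) / (((x : ℂ) - ((t : ℂ) + γ t * I)) ^ 2 + (y : ℂ) ^ 2)) *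
    (1 + (γ' t : ℂ) * I) with hk
  have hkc : Continuous k := continuous_poisson_kernel_graph hγc hγ'c hγ0 hxy
  have hgζ : Continuous fun t : ℝ => (1 + (γ' t : ℂ) * I) • g (t + γ t * I) :=
    .smul (by fun_prop) (hgc.comp_continuous hζ fun t => by simp)
  have hsplit : ∀ t : ℝ, k t • F (t + γ t * I) =
      k t • F z + (1 + (γ' t : ℂ) * I) • g (t + γ t * I) := by
    intro t
    have h1 := graph_ne_of_lt hxy t
    have h2 : (t : ℂ) + γ t * I - (x - y * I) ≠ 0 :=
      sub_conj_ne_of_nonneg (by simpa using hγ0 t) hy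
    rw [← sub_eq_iff_eq_add', ← smul_sub, hg, hk]
    simp only
    rw [dslope_of_ne _ (sub_ne_zero.1 h1), slope_def_module, smul_smul, smul_smul,
      poisson_denominator_eq]
    congr 1
    field_simp
  have hlim1 : Tendsto (fun T : ℝ => ∫ t in -T..T, k t • F (t + γ t * I)) atTop
      (𝓝 ((Real.pi : ℂ) • F z)) := by
    have h := ((tendsto_integral_poisson_kernel_graph hγ hγ'c hγ0 hfar hxy).smul_const
      (F z)).add hzero
    rw [add_zero] at h
    refine h.congr fun T => ?_
    simp_rw [hsplit]
    rw [intervalIntegral.integral_add ((hkc.fun_smul continuous_const).intervalIntegrable _ _)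
      (hgζ.intervalIntegrable _ _), intervalIntegral.integral_smul_const]
  have hlim2 : Tendsto (fun T : ℝ => ∫ t in -T..T, k t • F (t + γ t * I)) atTop
      (𝓝 (∫ t, k t • F (t + γ t * I))) :=
    intervalIntegral_tendsto_integral
      (integrable_poisson_kernel_graph_smul hγ hγ'c hγ0 hfar hxy hFζ fun t ht =>
        hbd _ (by simp [hfar t ht])) tendsto_neg_atTop_atBot tendsto_id
  rw [tendsto_nhds_unique hlim2 hlim1, smul_smul, ← ofReal_mul,
    one_div_mul_cancel Real.pi_ne_zero, ofReal_one, one_smul]
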